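/- Let (X, d) be a complete separable metric space and μ a Borel probability measure on X. For each n, let (Ω_n, A_n, P_n) be a probability space, let X_n, Y_n : Ω_n → X be Borel measurable random elements, let A_n⁰ ⊆ A_n be a sub-σ-algebra, and let μ_n and ν_n be regular conditional distributions for X_n and Y_n given A_n⁰. If the real random variables ρ(μ, μ_n(·)) converge to 0 in probability and d(X_n, Y_n) converges to 0 in probability as n → ∞, then ρ(μ, ν_n(·)) converges to 0 in probability. -/

import Mathlib

open MeasureTheory

/-- `g` has bounded-Lipschitz norm at most one:
`sup_x |g(x)| + sup_{x≠y} |g(x)-g(y)|/d(x,y) ≤ 1`. -/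
def BLNormLEOne {X : Type*} [MetricSpace X] (g : X → ℝ) : Prop :=
  ∃ c₁ c₂ : ℝ, 0 ≤ c₁ ∧ 0 ≤ c₂ ∧ c₁ + c₂ ≤ 1 ∧
    (∀ x, |g x| ≤ c₁) ∧ (∀ x y, |g x - g y| ≤ c₂ * dist x y)

/-- The bounded-Lipschitz metric on Borel probability measures on a metric space. -/
noncomputable def blDist {X : Type*} [MetricSpace X] [MeasurableSpace X]
    (μ ν : Measure X) : ℝ :=
  sSup {r : ℝ | ∃ g : X → ℝ, BLNormLEOne g ∧ r = |(∫ x, g x ∂μ) - ∫ x, g x ∂ν|}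

/-- `κ` is a regular conditional distribution for `Z : Ω → X` given the sub-σ-algebra `A₀`. -/
def IsRCD {Ω X : Type*} {mΩ : MeasurableSpace Ω} [MetricSpace X] [MeasurableSpace X]
    (P : Measure Ω) (A₀ : MeasurableSpace Ω) (Z : Ω → X) (κ : Ω → Measure X) : Prop :=
  (∀ ω, IsProbabilityMeasure (κ ω)) ∧
  (∀ B : Set X, MeasurableSet B → Measurable[A₀] (fun ω => κ ω B)) ∧
  (∀ A : Set Ω, MeasurableSet[A₀] A → ∀ B : Set X, MeasurableSet B →
    ∫ ω in A, (κ ω B).toReal ∂P = (P (A ∩ Z ⁻¹' B)).toReal)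

theorem abs_integral_le_one {X : Type*} [MeasurableSpace X] (μ : Measure X)
    [IsProbabilityMeasure μ] {g : X → ℝ} (hg : ∀ x, |g x| ≤ 1) : |∫ x, g x ∂μ| ≤ 1 := by
  have := norm_integral_le_of_norm_le_const (μ := μ) (f := g) (C := 1)
    (Filter.Eventually.of_forall fun x => by simpa using hg x)
  simpa using this

theorem BLNormLEOne.abs_le_one {X : Type*} [MetricSpace X] {g : X → ℝ} (hg : BLNormLEOne g)
    (x : X) : |g x| ≤ 1 := by
  obtain ⟨c₁, c₂, -, h₂, h, hb, -⟩ := hg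
  linarith [hb x]

theorem BLNormLEOne.abs_sub_le {X : Type*} [MetricSpace X] {g : X → ℝ} (hg : BLNormLEOne g)
    (x y : X) : |g x - g y| ≤ dist x y := by
  obtain ⟨c₁, c₂, h₁, -, h, -, hl⟩ := hg
  exact (hl x y).trans (mul_le_of_le_one_left dist_nonneg (by linarith))

theorem BLNormLEOne.abs_integral_sub_le_blDist {X : Type*} [MetricSpace X] [MeasurableSpace X]
    (μ ν : Measure X) [IsProbabilityMeasure μ] [IsProbabilityMeasure ν] {g : X → ℝ}
    (hg : BLNormLEOne g) : |(∫ x, g x ∂μ) - ∫ x, g x ∂ν| ≤ blDist μ ν := by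
  refine le_csSup ⟨2, ?_⟩ ⟨g, hg, rfl⟩
  rintro r ⟨f, hf, rfl⟩
  have h₁ := abs_integral_le_one μ hf.abs_le_one
  have h₂ := abs_integral_le_one ν hf.abs_le_one
  exact (abs_sub _ _).trans (by linarith)

theorem continuous_of_abs_sub_le {X : Type*} [MetricSpace X] {h : X → ℝ} {L : ℝ}
    (hL : ∀ x y, |h x - h y| ≤ L * dist x y) : Continuous h :=
  (LipschitzWith.of_dist_le' (K := L) fun x y => by rw [Real.dist_eq]; exact hL x y).continuous

theorem abs_integral_sub_le_mul_blDist {X : Type*} [MetricSpace X] [MeasurableSpace X]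
    (μ ν : Measure X) [IsProbabilityMeasure μ] [IsProbabilityMeasure ν] {h : X → ℝ} {L : ℝ}
    (hL₀ : 0 ≤ L) (h₀ : ∀ x, 0 ≤ h x) (h₁ : ∀ x, h x ≤ 1)
    (hL : ∀ x y, |h x - h y| ≤ L * dist x y) :
    |(∫ x, h x ∂μ) - ∫ x, h x ∂ν| ≤ (1 + L) * blDist μ ν := by
  have hpos : 0 < 1 + L := by linarith
  have hg : BLNormLEOne fun x => (1 + L)⁻¹ * h x := by
    refine ⟨(1 + L)⁻¹, (1 + L)⁻¹ * L, by positivity, by positivity, ?_, fun x => ?_, fun x y => ?_⟩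
    · field_simp; exact le_rfl
    · rw [abs_of_nonneg (mul_nonneg (by positivity) (h₀ x))]
      exact mul_le_of_le_one_right (by positivity) (h₁ x)
    · rw [← mul_sub, abs_mul, abs_of_pos (inv_pos.2 hpos), mul_assoc]
      exact mul_le_mul_of_nonneg_left (hL x y) (by positivity)
  have := hg.abs_integral_sub_le_blDist μ ν
  rw [integral_const_mul, integral_const_mul, ← mul_sub, abs_mul,
    abs_of_pos (inv_pos.2 hpos)] at this
  rwa [inv_mul_le_iff₀ hpos] at this

theorem IsRCD.aemeasurable_apply {Ω X : Type*} {A₀ mΩ : MeasurableSpace Ω} [MetricSpace X]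
    [MeasurableSpace X] {P : Measure Ω} [IsProbabilityMeasure P]
    {Z : Ω → X} {κ : Ω → Measure X} (hκ : IsRCD P A₀ Z κ) (hZ : Measurable Z) {B : Set X}
    (hB : MeasurableSet B) : AEMeasurable (fun ω => κ ω B) P := by
  have : ∀ ω, IsProbabilityMeasure (κ ω) := hκ.1
  suffices h : Integrable (fun ω => (κ ω B).toReal) P by
    simpa [ENNReal.ofReal_toReal (measure_ne_top _ _)] using h.aemeasurable.ennreal_ofReal
  by_contra hni
  have hc : (fun ω => (κ ω Bᶜ).toReal) = fun ω => 1 - (κ ω B).toReal :=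
    funext fun ω => probReal_compl_eq_one_sub hB
  have hni' : ¬ Integrable (fun ω => (κ ω Bᶜ).toReal) P := fun hi => hni <| by
    have := (integrable_const (1 : ℝ)).sub hi
    rw [hc] at this
    exact this.congr (by filter_upwards with ω; simp)
  have e₁ := hκ.2.2 Set.univ MeasurableSet.univ B hB
  have e₂ := hκ.2.2 Set.univ MeasurableSet.univ Bᶜ hB.compl
  rw [Measure.restrict_univ, integral_undef hni, Set.univ_inter] at e₁
  rw [Measure.restrict_univ, integral_undef hni', Set.univ_inter, Set.preimage_compl] at e₂
  have e₃ : P.real (Z ⁻¹' B)ᶜ = 1 - P.real (Z ⁻¹' B) := probReal_compl_eq_one_sub (hZ hB)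
  simp only [Measure.real] at e₃
  linarith

theorem IsRCD.aemeasurable_lintegral_and_setLIntegral {Ω X : Type*} {A₀ mΩ : MeasurableSpace Ω}
    [MetricSpace X] [MeasurableSpace X] {P : Measure Ω} [IsProbabilityMeasure P] {Z : Ω → X} {κ : Ω → Measure X} (hκ : IsRCD P A₀ Z κ)
    (hZ : Measurable Z) {f : X → ENNReal} (hf : Measurable f) :
    AEMeasurable (fun ω => ∫⁻ x, f x ∂κ ω) P ∧
      ∀ A, MeasurableSet[A₀] A →
        ∫⁻ ω in A, ∫⁻ x, f x ∂κ ω ∂P = ∫⁻ ω in A, f (Z ω) ∂P := by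
  have : ∀ ω, IsProbabilityMeasure (κ ω) := hκ.1
  refine Measurable.ennreal_induction (fun c B hB => ?_) (fun f g _ hf hg ihf ihg => ?_)
    (fun f hf hmono ih => ?_) hf
  · have hm := hκ.aemeasurable_apply hZ hB
    have e : (fun ω => ∫⁻ x, B.indicator (fun _ => c) x ∂κ ω) = fun ω => c * κ ω B :=
      funext fun ω => lintegral_indicator_const hB c
    rw [e]
    refine ⟨hm.const_mul c, fun A hA => ?_⟩
    have e' : (fun ω => B.indicator (fun _ => c) (Z ω)) =
        (Z ⁻¹' B).indicator fun _ => c := rfl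
    rw [lintegral_const_mul'' _ hm.restrict, e', lintegral_indicator_const (hZ hB),
      Measure.restrict_apply (hZ hB), Set.inter_comm]
    congr 1
    have h := hκ.2.2 A hA B hB
    rw [integral_toReal hm.restrict (Filter.Eventually.of_forall fun ω => measure_lt_top _ _)] at h
    refine (ENNReal.toReal_eq_toReal_iff' (ne_of_lt ?_) (measure_ne_top _ _)).1 h
    calc ∫⁻ ω in A, κ ω B ∂P ≤ ∫⁻ _ in A, 1 ∂P := lintegral_mono fun ω => prob_le_one
      _ < ⊤ := by simp
  · have e : (fun ω => ∫⁻ x, (f + g) x ∂κ ω) =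
        fun ω => (∫⁻ x, f x ∂κ ω) + ∫⁻ x, g x ∂κ ω :=
      funext fun ω => lintegral_add_left hf g
    rw [e]
    refine ⟨ihf.1.add ihg.1, fun A hA => ?_⟩
    rw [lintegral_add_left' ihf.1.restrict, ihf.2 A hA, ihg.2 A hA]
    exact (lintegral_add_left (hf.comp hZ) _).symm
  · have e : (fun ω => ∫⁻ x, ⨆ n, f n x ∂κ ω) = fun ω => ⨆ n, ∫⁻ x, f n x ∂κ ω :=
      funext fun ω => lintegral_iSup hf hmono
    simp only [e]
    refine ⟨AEMeasurable.iSup fun n => (ih n).1, fun A hA => ?_⟩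
    rw [lintegral_iSup' (fun n => (ih n).1.restrict)
      (Filter.Eventually.of_forall fun ω i j hij => lintegral_mono (hmono hij))]
    exact (iSup_congr fun n => (ih n).2 A hA).trans
      (lintegral_iSup (fun n => (hf n).comp hZ) fun i j hij ω => hmono hij (Z ω)).symm

theorem IsRCD.measurable_lintegral {Ω X : Type*} {A₀ mΩ : MeasurableSpace Ω}
    [MetricSpace X] [MeasurableSpace X] {P : Measure Ω} {Z : Ω → X} {κ : Ω → Measure X} (hκ : IsRCD P A₀ Z κ)
    {f : X → ENNReal} (hf : Measurable f) : Measurable[A₀] (fun ω => ∫⁻ x, f x ∂κ ω) :=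
  (Measure.measurable_lintegral hf).comp
    (Measure.measurable_of_measurable_coe κ hκ.2.1)

theorem IsRCD.measure_integral_sub_ge_le {Ω X : Type*} {A₀ mΩ : MeasurableSpace Ω}
    [MetricSpace X] [TopologicalSpace.SeparableSpace X] [MeasurableSpace X] [BorelSpace X]
    {P : Measure Ω} [IsProbabilityMeasure P] {Z W : Ω → X} {κ τ : Ω → Measure X}
    (hκ : IsRCD P A₀ Z κ) (hτ : IsRCD P A₀ W τ) (hZ : Measurable Z) (hW : Measurable W)
    {h : X → ℝ} {L : ℝ} (hL₀ : 0 ≤ L) (h₀ : ∀ x, 0 ≤ h x) (h₁ : ∀ x, h x ≤ 1)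
    (hL : ∀ x y, |h x - h y| ≤ L * dist x y) {δ : ℝ} (hδ : 0 < δ) (η : ℝ) :
    ENNReal.ofReal δ * P {ω | δ ≤ (∫ x, h x ∂κ ω) - ∫ x, h x ∂τ ω} ≤
      ENNReal.ofReal (L * η) + P {ω | η ≤ dist (Z ω) (W ω)} := by
  have : ∀ ω, IsProbabilityMeasure (κ ω) := hκ.1
  have : ∀ ω, IsProbabilityMeasure (τ ω) := hτ.1
  have : SecondCountableTopology X := UniformSpace.secondCountable_of_separable X
  have hc : Continuous h := continuous_of_abs_sub_le hL
  have hmeas : Measurable fun x => ENNReal.ofReal (h x) := hc.measurable.ennreal_ofReal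
  set f : X → ENNReal := fun x => ENNReal.ofReal (h x) with hf
  have hf1 : ∀ x, f x ≤ 1 := fun x => by simpa [hf] using h₁ x
  have hint : ∀ ν : Measure X, IsProbabilityMeasure ν → ENNReal.ofReal (∫ x, h x ∂ν) =
      ∫⁻ x, f x ∂ν := fun ν _ =>
    ofReal_integral_eq_lintegral_ofReal
      (Integrable.of_bound hc.aestronglyMeasurable 1
        (Filter.Eventually.of_forall fun x => by
          rw [Real.norm_eq_abs, abs_of_nonneg (h₀ x)]; exact h₁ x))
      (Filter.Eventually.of_forall h₀)
  obtain ⟨hFm, hF⟩ := hκ.aemeasurable_lintegral_and_setLIntegral hZ hmeas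
  obtain ⟨hGm, hG⟩ := hτ.aemeasurable_lintegral_and_setLIntegral hW hmeas
  set A : Set Ω := {ω | ENNReal.ofReal δ + ∫⁻ x, f x ∂τ ω ≤ ∫⁻ x, f x ∂κ ω} with hA
  have hAset : {ω | δ ≤ (∫ x, h x ∂κ ω) - ∫ x, h x ∂τ ω} ⊆ A := by
    intro ω hω
    simp only [Set.mem_ofPred_eq] at hω
    simp only [hA, Set.mem_ofPred_eq]
    rw [← hint _ (hκ.1 ω), ← hint _ (hτ.1 ω),
      ← ENNReal.ofReal_add hδ.le (integral_nonneg h₀)]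
    exact ENNReal.ofReal_le_ofReal (by linarith)
  have hA₀ : MeasurableSet[A₀] A :=
    @measurableSet_le _ _ _ _ _ A₀ _ _ _ _ _
      ((measurable_const_add (ENNReal.ofReal δ)).comp (hτ.measurable_lintegral hmeas))
      (hκ.measurable_lintegral hmeas)
  have hAn : NullMeasurableSet A P := nullMeasurableSet_le (hGm.const_add _) hFm
  have hD : MeasurableSet {ω | η ≤ dist (Z ω) (W ω)} :=
    measurableSet_le measurable_const (hZ.dist hW)
  have hpt : ∀ ω, f (Z ω) ≤ f (W ω) + (ENNReal.ofReal (L * η) +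
      {ω | η ≤ dist (Z ω) (W ω)}.indicator (fun _ => 1) ω) := by
    intro ω
    by_cases hω : η ≤ dist (Z ω) (W ω)
    · rw [Set.indicator_of_mem (by exact hω)]
      exact (hf1 _).trans (le_add_self.trans (le_add_self))
    · rw [Set.indicator_of_notMem (by exact hω), add_zero]
      have h₂ : h (Z ω) ≤ h (W ω) + L * η := by
        have := (abs_le.1 (hL (Z ω) (W ω))).2
        have := mul_le_mul_of_nonneg_left (not_le.1 hω).le hL₀
        linarith
      exact (ENNReal.ofReal_le_ofReal h₂).trans ENNReal.ofReal_add_le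
  have hfin : ∫⁻ ω in A, f (W ω) ∂P ≠ ⊤ := by
    refine ne_of_lt ?_
    calc ∫⁻ ω in A, f (W ω) ∂P ≤ ∫⁻ _ in A, 1 ∂P := lintegral_mono fun ω => hf1 _
      _ < ⊤ := by simp
  refine (mul_le_mul_right (measure_mono hAset) _).trans ?_
  refine (ENNReal.add_le_add_iff_left hfin).1 ?_
  calc ∫⁻ ω in A, f (W ω) ∂P + ENNReal.ofReal δ * P A
      = ∫⁻ ω in A, (ENNReal.ofReal δ + ∫⁻ x, f x ∂τ ω) ∂P := by
        rw [lintegral_add_left measurable_const, hG A hA₀, setLIntegral_const, add_comm]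
    _ ≤ ∫⁻ ω in A, ∫⁻ x, f x ∂κ ω ∂P := by
        refine lintegral_mono_ae ?_
        filter_upwards [ae_restrict_mem₀ hAn] with ω hω using hω
    _ = ∫⁻ ω in A, f (Z ω) ∂P := hF A hA₀
    _ ≤ ∫⁻ ω in A, (f (W ω) + (ENNReal.ofReal (L * η) +
          {ω | η ≤ dist (Z ω) (W ω)}.indicator (fun _ => 1) ω)) ∂P := lintegral_mono hpt
    _ = ∫⁻ ω in A, f (W ω) ∂P + ∫⁻ ω in A, (ENNReal.ofReal (L * η) +
          {ω | η ≤ dist (Z ω) (W ω)}.indicator (fun _ => 1) ω) ∂P :=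
        lintegral_add_left (hmeas.comp hW) _
    _ ≤ ∫⁻ ω in A, f (W ω) ∂P + ∫⁻ ω, (ENNReal.ofReal (L * η) +
          {ω | η ≤ dist (Z ω) (W ω)}.indicator (fun _ => 1) ω) ∂P := by
        gcongr; exact Measure.restrict_le_self
    _ = _ := by
        rw [lintegral_add_left measurable_const, lintegral_indicator_const hD]
        simp

open Filter Topology in
theorem tendsto_measure_abs_integral_sub
    {X : Type*} [MetricSpace X] [TopologicalSpace.SeparableSpace X]
    [MeasurableSpace X] [BorelSpace X] (μ : Measure X) [IsProbabilityMeasure μ]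
    {Ω : ℕ → Type*} {A₀ mΩ : ∀ n, MeasurableSpace (Ω n)}
    {P : ∀ n, Measure (Ω n)} [∀ n, IsProbabilityMeasure (P n)]
    {Xn Yn : ∀ n, Ω n → X} (hXn : ∀ n, Measurable (Xn n)) (hYn : ∀ n, Measurable (Yn n))
    {μn νn : ∀ n, Ω n → Measure X}
    (hμn : ∀ n, IsRCD (P n) (A₀ n) (Xn n) (μn n))
    (hνn : ∀ n, IsRCD (P n) (A₀ n) (Yn n) (νn n))
    (hρμ : ∀ δ : ℝ, 0 < δ → Tendsto (fun n => P n {ω | δ ≤ blDist μ (μn n ω)}) atTop (𝓝 0))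
    (hd : ∀ δ : ℝ, 0 < δ →
      Tendsto (fun n => P n {ω | δ ≤ dist (Xn n ω) (Yn n ω)}) atTop (𝓝 0))
    {h : X → ℝ} {L : ℝ} (hL₀ : 0 ≤ L) (h₀ : ∀ x, 0 ≤ h x) (h₁ : ∀ x, h x ≤ 1)
    (hL : ∀ x y, |h x - h y| ≤ L * dist x y) {δ : ℝ} (hδ : 0 < δ) :
    Tendsto (fun n => P n {ω | δ ≤ |(∫ x, h x ∂μ) - ∫ x, h x ∂νn n ω|}) atTop (𝓝 0) := by
  have hδ2 : 0 < δ / 2 := by positivity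
  have hcond : Tendsto (fun n => ENNReal.ofReal (δ / 2) *
      P n {ω | δ / 2 ≤ |(∫ x, h x ∂μn n ω) - ∫ x, h x ∂νn n ω|}) atTop (𝓝 0) := by
    refine ENNReal.tendsto_nhds_zero.2 fun ε hε => ?_
    obtain ⟨e, he, heε⟩ : ∃ e : ℝ, 0 < e ∧ ENNReal.ofReal e * 4 ≤ ε := by
      rcases eq_or_ne ε ⊤ with rfl | hε'
      · exact ⟨1, one_pos, le_top⟩
      · refine ⟨ε.toReal / 4, by have := ENNReal.toReal_pos hε.ne' hε'; positivity, ?_⟩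
        rw [show (4 : ENNReal) = ENNReal.ofReal 4 by simp, ← ENNReal.ofReal_mul (by positivity),
          div_mul_cancel₀ _ (by norm_num), ENNReal.ofReal_toReal hε']
    have hη : 0 < e / (1 + L) := by positivity
    have hLη : L * (e / (1 + L)) ≤ e := by
      rw [← mul_div_assoc, div_le_iff₀ (by positivity)]; nlinarith
    filter_upwards [ENNReal.tendsto_nhds_zero.1 (hd _ hη) (ENNReal.ofReal e)
      (ENNReal.ofReal_pos.2 he)] with n hn
    have b₁ := (hμn n).measure_integral_sub_ge_le (hνn n) (hXn n) (hYn n) hL₀ h₀ h₁ hL hδ2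
      (e / (1 + L))
    have b₂ := (hνn n).measure_integral_sub_ge_le (hμn n) (hYn n) (hXn n) hL₀ h₀ h₁ hL hδ2
      (e / (1 + L))
    simp only [dist_comm (Yn n _)] at b₂
    have hsub : {ω | δ / 2 ≤ |(∫ x, h x ∂μn n ω) - ∫ x, h x ∂νn n ω|} ⊆
        {ω | δ / 2 ≤ (∫ x, h x ∂μn n ω) - ∫ x, h x ∂νn n ω} ∪
        {ω | δ / 2 ≤ (∫ x, h x ∂νn n ω) - ∫ x, h x ∂μn n ω} := by
      intro ω hω
      simpa only [Set.mem_union, Set.mem_ofPred_eq, le_abs, neg_sub] using hω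
    have hb : ENNReal.ofReal (L * (e / (1 + L))) +
        P n {ω | e / (1 + L) ≤ dist (Xn n ω) (Yn n ω)} ≤
        ENNReal.ofReal e + ENNReal.ofReal e := add_le_add (ENNReal.ofReal_le_ofReal hLη) hn
    calc _ ≤ ENNReal.ofReal (δ / 2) *
          (P n {ω | δ / 2 ≤ (∫ x, h x ∂μn n ω) - ∫ x, h x ∂νn n ω} +
           P n {ω | δ / 2 ≤ (∫ x, h x ∂νn n ω) - ∫ x, h x ∂μn n ω}) := by
          gcongr; exact (measure_mono hsub).trans (measure_union_le _ _)
      _ ≤ (ENNReal.ofReal e + ENNReal.ofReal e) + (ENNReal.ofReal e + ENNReal.ofReal e) := by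
          rw [mul_add]; exact add_le_add (b₁.trans hb) (b₂.trans hb)
      _ = ENNReal.ofReal e * 4 := by ring
      _ ≤ ε := heε
  have hcond' : Tendsto (fun n =>
      P n {ω | δ / 2 ≤ |(∫ x, h x ∂μn n ω) - ∫ x, h x ∂νn n ω|}) atTop (𝓝 0) := by
    have hne : ENNReal.ofReal (δ / 2) ≠ 0 := (ENNReal.ofReal_pos.2 hδ2).ne'
    have := ENNReal.Tendsto.const_mul (a := (ENNReal.ofReal (δ / 2))⁻¹) hcond
      (Or.inr (ENNReal.inv_ne_top.2 hne))
    simpa only [← mul_assoc, ENNReal.inv_mul_cancel hne ENNReal.ofReal_ne_top, one_mul,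
      mul_zero] using this
  have hpos : 0 < 1 + L := by positivity
  have hsum := (hρμ (δ / 2 / (1 + L)) (by positivity)).add hcond'
  rw [add_zero] at hsum
  refine tendsto_of_tendsto_of_tendsto_of_le_of_le tendsto_const_nhds hsum
    (fun _ => zero_le) fun n => ?_
  refine (measure_mono fun ω hω => ?_).trans (measure_union_le _ _)
  by_contra hcon
  simp only [Set.mem_union, Set.mem_ofPred_eq, not_or, not_le] at hcon hω
  have := (hμn n).1 ω
  have k₁ := abs_integral_sub_le_mul_blDist μ (μn n ω) hL₀ h₀ h₁ hL
  have k₂ := (lt_div_iff₀' hpos).1 hcon.1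
  have k₃ := abs_sub_le (∫ x, h x ∂μ) (∫ x, h x ∂μn n ω) (∫ x, h x ∂νn n ω)
  linarith [hcon.2]

/-- Finitely many Lipschitz functions, forming a partition of unity on a set of large
`μ`-measure, control the bounded-Lipschitz distance to `μ`. -/
theorem exists_finset_blDist_le {X : Type*} [MetricSpace X] [CompleteSpace X]
    [TopologicalSpace.SeparableSpace X] [MeasurableSpace X] [BorelSpace X]
    (μ : Measure X) [IsProbabilityMeasure μ] {ε : ℝ} (hε : 0 < ε) :
    ∃ (t : Finset X) (ψ : X → X → ℝ) (L : ℝ), 0 ≤ L ∧ (∀ a x, 0 ≤ ψ a x) ∧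
      (∀ a x, a ∈ t → ψ a x ≤ 1) ∧
      (∀ a ∈ t, ∀ x y, |ψ a x - ψ a y| ≤ L * dist x y) ∧
      ∀ ν : Measure X, IsProbabilityMeasure ν →
        blDist μ ν ≤ 2 * ∑ a ∈ t, |(∫ x, ψ a x ∂μ) - ∫ x, ψ a x ∂ν| + 6 * ε := by
  have : SecondCountableTopology X := UniformSpace.secondCountable_of_separable X
  obtain ⟨K, hK, hKμ⟩ : ∃ K : Set X, IsCompact K ∧ μ Kᶜ ≤ ENNReal.ofReal ε := by
    have := isTightMeasureSet_iff_exists_isCompact_measure_compl_le.1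
      (isTightMeasureSet_singleton (μ := μ)) _ (ENNReal.ofReal_pos.2 hε)
    simpa using this
  obtain ⟨s, -, hs, hcov⟩ := hK.finite_cover_balls hε
  set t := hs.toFinset with ht
  set φ : X → X → ℝ := fun a x => max 0 (2 * ε - dist x a) with hφ
  set M : X → ℝ := fun x => max ε (∑ a ∈ t, φ a x) with hM
  set ψ : X → X → ℝ := fun a x => φ a x / M x with hψ
  have hφ0 : ∀ a x, 0 ≤ φ a x := fun a x => le_max_left _ _
  have hMε : ∀ x, ε ≤ M x := fun x => le_max_left _ _
  have hM0 : ∀ x, 0 < M x := fun x => hε.trans_le (hMε x)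
  have hψ0 : ∀ a x, 0 ≤ ψ a x := fun a x => div_nonneg (hφ0 a x) (hM0 x).le
  have hψsum : ∀ x, ∑ a ∈ t, ψ a x ≤ 1 := fun x => by
    rw [hψ, ← Finset.sum_div]
    exact (div_le_one (hM0 x)).2 (le_max_right _ _)
  have hψ1 : ∀ a x, a ∈ t → ψ a x ≤ 1 := fun a x ha =>
    (Finset.single_le_sum (f := fun a => ψ a x) (fun b _ => hψ0 b x) ha).trans (hψsum x)
  have hφL : ∀ a x y, |φ a x - φ a y| ≤ dist x y := fun a x y => by
    calc |φ a x - φ a y| ≤ |(2 * ε - dist x a) - (2 * ε - dist y a)| := by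
          simpa only [hφ, max_comm (0 : ℝ)] using
            abs_max_sub_max_le_abs (2 * ε - dist x a) (2 * ε - dist y a) 0
      _ = |dist y a - dist x a| := by congr 1; ring
      _ ≤ dist x y := by rw [dist_comm x y]; exact abs_dist_sub_le y x a
  have hML : ∀ x y, |M x - M y| ≤ t.card * dist x y := fun x y => by
    calc |M x - M y| ≤ |∑ a ∈ t, φ a x - ∑ a ∈ t, φ a y| := by
          simpa only [hM, max_comm ε] using
            abs_max_sub_max_le_abs (∑ a ∈ t, φ a x) (∑ a ∈ t, φ a y) ε
      _ ≤ ∑ a ∈ t, |φ a x - φ a y| := by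
          rw [← Finset.sum_sub_distrib]; exact Finset.abs_sum_le_sum_abs _ _
      _ ≤ ∑ _a ∈ t, dist x y := Finset.sum_le_sum fun a _ => hφL a x y
      _ = t.card * dist x y := by simp
  have hψL : ∀ a ∈ t, ∀ x y, |ψ a x - ψ a y| ≤ ((1 + t.card) / ε) * dist x y := by
    intro a ha x y
    have e : ψ a x - ψ a y = ((φ a x - φ a y) + ψ a y * (M y - M x)) / M x := by
      have := (hM0 x).ne'
      have := (hM0 y).ne'
      simp only [hψ]; field_simp; ring
    rw [e, abs_div, abs_of_pos (hM0 x), div_mul_eq_mul_div ((1 : ℝ) + _)]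
    refine div_le_div₀ (by positivity) ?_ hε (hMε x)
    calc _ ≤ |φ a x - φ a y| + |ψ a y * (M y - M x)| := abs_add_le _ _
      _ ≤ dist x y + 1 * (t.card * dist x y) := by
          rw [abs_mul, abs_of_nonneg (hψ0 a y), abs_sub_comm (M y)]
          exact add_le_add (hφL a x y)
            (mul_le_mul (hψ1 a y ha) (hML x y) (abs_nonneg _) zero_le_one)
      _ = _ := by ring
  have hψc : ∀ a ∈ t, Continuous (ψ a) := fun a ha => continuous_of_abs_sub_le (hψL a ha)
  have hψi : ∀ ν : Measure X, IsProbabilityMeasure ν → ∀ a ∈ t, Integrable (ψ a) ν :=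
    fun ν _ a ha => Integrable.of_bound (hψc a ha).aestronglyMeasurable 1
      (Filter.Eventually.of_forall fun x => by
        rw [Real.norm_eq_abs, abs_of_nonneg (hψ0 a x)]; exact hψ1 a x ha)
  have hμK : 1 - ∑ a ∈ t, ∫ x, ψ a x ∂μ ≤ ε := by
    have hψK : ∀ x, 1 - ∑ a ∈ t, ψ a x ≤ Kᶜ.indicator (fun _ => (1 : ℝ)) x := by
      intro x
      by_cases hx : x ∈ K
      · rw [Set.indicator_of_notMem (by simpa using hx)]
        obtain ⟨a, ha, hxa⟩ := Set.mem_iUnion₂.1 (hcov hx)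
        have hat : a ∈ t := by simpa [ht] using ha
        have h₁ : ε ≤ ∑ a ∈ t, φ a x := by
          refine le_trans ?_ (Finset.single_le_sum (f := fun a => φ a x)
            (fun b _ => hφ0 b x) hat)
          refine le_trans ?_ (le_max_right _ _)
          have := Metric.mem_ball.1 hxa
          linarith
        have h₂ : M x = ∑ a ∈ t, φ a x := max_eq_right h₁
        rw [hψ, ← Finset.sum_div, h₂, div_self (hε.trans_le h₁).ne', sub_self]
      · rw [Set.indicator_of_mem hx]
        linarith [Finset.sum_nonneg fun a (_ : a ∈ t) => hψ0 a x]
    calc 1 - ∑ a ∈ t, ∫ x, ψ a x ∂μ = ∫ x, (1 - ∑ a ∈ t, ψ a x) ∂μ := by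
          rw [integral_sub (integrable_const _) (integrable_finsetSum _ (hψi μ inferInstance)),
            integral_finsetSum _ (hψi μ inferInstance)]
          simp
      _ ≤ ∫ x, Kᶜ.indicator (fun _ => (1 : ℝ)) x ∂μ :=
          integral_mono ((integrable_const _).sub (integrable_finsetSum _ (hψi μ inferInstance)))
            ((integrable_const _).indicator hK.measurableSet.compl) hψK
      _ = μ.real Kᶜ := by
          simpa using integral_indicator_const (μ := μ) (1 : ℝ) hK.measurableSet.compl
      _ ≤ ε := ENNReal.toReal_le_of_le_ofReal hε.le hKμ
  refine ⟨t, ψ, (1 + t.card) / ε, by positivity, hψ0, hψ1, hψL, fun ν hν => ?_⟩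
  set D := ∑ a ∈ t, |(∫ x, ψ a x ∂μ) - ∫ x, ψ a x ∂ν| with hD
  have hνK : 1 - ∑ a ∈ t, ∫ x, ψ a x ∂ν ≤ ε + D := by
    have : ∑ a ∈ t, ∫ x, ψ a x ∂μ - ∑ a ∈ t, ∫ x, ψ a x ∂ν ≤ D := by
      rw [← Finset.sum_sub_distrib]
      exact Finset.sum_le_sum fun a _ => le_abs_self _
    linarith
  refine csSup_le ⟨0, fun _ => 0, ⟨0, 0, by simp⟩, by simp⟩ ?_
  rintro r ⟨g, hg, rfl⟩
  have hgc : Continuous g :=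
    continuous_of_abs_sub_le (L := 1) fun x y => by simpa using hg.abs_sub_le x y
  have happrox : ∀ x, |g x - ∑ a ∈ t, g a * ψ a x| ≤ 2 * ε + (1 - ∑ a ∈ t, ψ a x) := by
    intro x
    have e : g x - ∑ a ∈ t, g a * ψ a x =
        ∑ a ∈ t, (g x - g a) * ψ a x + g x * (1 - ∑ a ∈ t, ψ a x) := by
      simp only [sub_mul, Finset.sum_sub_distrib, ← Finset.mul_sum]; ring
    have h1 := hψsum x
    rw [e]
    refine (abs_add_le _ _).trans (add_le_add ?_ ?_)
    · calc _ ≤ ∑ a ∈ t, |(g x - g a) * ψ a x| := Finset.abs_sum_le_sum_abs _ _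
        _ ≤ ∑ a ∈ t, 2 * ε * ψ a x := by
            refine Finset.sum_le_sum fun a _ => ?_
            rw [abs_mul, abs_of_nonneg (hψ0 a x)]
            rcases le_total (dist x a) (2 * ε) with hxa | hxa
            · exact mul_le_mul_of_nonneg_right ((hg.abs_sub_le x a).trans hxa) (hψ0 a x)
            · have : ψ a x = 0 := by
                simp only [hψ, hφ]
                rw [max_eq_left (by linarith), zero_div]
              simp [this]
        _ = 2 * ε * ∑ a ∈ t, ψ a x := by rw [Finset.mul_sum]
        _ ≤ 2 * ε := mul_le_of_le_one_right (by positivity) h1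
    · rw [abs_mul, abs_of_nonneg (by linarith : 0 ≤ 1 - ∑ a ∈ t, ψ a x)]
      exact mul_le_of_le_one_left (by linarith) (hg.abs_le_one x)
  have hint : ∀ τ : Measure X, IsProbabilityMeasure τ →
      |(∫ x, g x ∂τ) - ∑ a ∈ t, g a * ∫ x, ψ a x ∂τ| ≤
        2 * ε + (1 - ∑ a ∈ t, ∫ x, ψ a x ∂τ) := by
    intro τ hτ
    have hgi : Integrable g τ := Integrable.of_bound hgc.aestronglyMeasurable 1
      (Filter.Eventually.of_forall hg.abs_le_one)
    have hi₁ : ∀ a ∈ t, Integrable (fun x => g a * ψ a x) τ :=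
      fun a ha => (hψi τ hτ a ha).const_mul _
    have hi₂ : Integrable (fun x => ∑ a ∈ t, ψ a x) τ := integrable_finsetSum _ (hψi τ hτ)
    have e₁ : (∫ x, g x ∂τ) - ∑ a ∈ t, g a * ∫ x, ψ a x ∂τ =
        ∫ x, (g x - ∑ a ∈ t, g a * ψ a x) ∂τ := by
      rw [integral_sub hgi (integrable_finsetSum _ hi₁), integral_finsetSum _ hi₁]
      simp only [integral_const_mul]
    have e₂ : 2 * ε + (1 - ∑ a ∈ t, ∫ x, ψ a x ∂τ) =
        ∫ x, (2 * ε + (1 - ∑ a ∈ t, ψ a x)) ∂τ := by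
      rw [integral_add (g := fun x => 1 - ∑ a ∈ t, ψ a x) (integrable_const _)
          ((integrable_const _).sub hi₂), integral_sub (integrable_const _) hi₂, integral_finsetSum _ (hψi τ hτ)]
      simp
    rw [e₁, e₂]
    exact (abs_integral_le_integral_abs).trans (integral_mono
      (hgi.sub (integrable_finsetSum _ hi₁)).abs
      ((integrable_const _).add ((integrable_const _).sub hi₂)) happrox)
  have hmid : |∑ a ∈ t, g a * ∫ x, ψ a x ∂μ - ∑ a ∈ t, g a * ∫ x, ψ a x ∂ν| ≤ D := by
    rw [← Finset.sum_sub_distrib]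
    refine (Finset.abs_sum_le_sum_abs _ _).trans (Finset.sum_le_sum fun a _ => ?_)
    rw [← mul_sub, abs_mul]
    exact mul_le_of_le_one_left (abs_nonneg _) (hg.abs_le_one a)
  have i₁ := abs_le.1 (hint μ inferInstance)
  have i₂ := abs_le.1 (hint ν hν)
  have i₃ := abs_le.1 hmid
  exact abs_le.2 ⟨by linarith [i₁.1, i₂.2, i₃.1], by linarith [i₁.2, i₂.1, i₃.2]⟩

/-- conditional Slutzky's theorem. If `ρ(μ, μₙ(·)) → 0` in probability and
`d(Xₙ, Yₙ) → 0` in probability, then `ρ(μ, νₙ(·)) → 0` in probability. -/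
theorem conditional_slutzky
    {X : Type*} [MetricSpace X] [CompleteSpace X] [TopologicalSpace.SeparableSpace X]
    [MeasurableSpace X] [BorelSpace X]
    (μ : Measure X) [IsProbabilityMeasure μ]
    (Ω : ℕ → Type*) [∀ n, MeasurableSpace (Ω n)]
    (P : ∀ n, Measure (Ω n)) [∀ n, IsProbabilityMeasure (P n)]
    (Xn Yn : ∀ n, Ω n → X)
    (hXn : ∀ n, Measurable (Xn n)) (hYn : ∀ n, Measurable (Yn n))
    (A₀ : ∀ n, MeasurableSpace (Ω n)) (hA₀ : ∀ n, A₀ n ≤ ‹∀ n, MeasurableSpace (Ω n)› n)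
    (μn νn : ∀ n, Ω n → Measure X)
    (hμn : ∀ n, IsRCD (P n) (A₀ n) (Xn n) (μn n))
    (hνn : ∀ n, IsRCD (P n) (A₀ n) (Yn n) (νn n))
    (hρμ : ∀ δ : ℝ, 0 < δ →
      Filter.Tendsto (fun n => P n {ω | δ ≤ blDist μ (μn n ω)}) Filter.atTop (nhds 0))
    (hd : ∀ δ : ℝ, 0 < δ →
      Filter.Tendsto (fun n => P n {ω | δ ≤ dist (Xn n ω) (Yn n ω)}) Filter.atTop (nhds 0)) :
    ∀ δ : ℝ, 0 < δ →
      Filter.Tendsto (fun n => P n {ω | δ ≤ blDist μ (νn n ω)}) Filter.atTop (nhds 0) := by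
  intro δ hδ
  obtain ⟨t, ψ, L, hL₀, h₀, h₁, hL, hbound⟩ :=
    exists_finset_blDist_le μ (ε := δ / 12) (by positivity)
  set c : ℝ := δ / 4 / (t.card + 1) with hc
  have hcpos : 0 < c := by positivity
  have hsum : Filter.Tendsto (fun n => ∑ a ∈ t,
      P n {ω | c ≤ |(∫ x, ψ a x ∂μ) - ∫ x, ψ a x ∂νn n ω|}) Filter.atTop (nhds 0) := by
    simpa using tendsto_finsetSum t fun a ha =>
      tendsto_measure_abs_integral_sub μ hXn hYn hμn hνn hρμ hd hL₀ (h₀ a)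
        (fun x => h₁ a x ha) (hL a ha) hcpos
  refine tendsto_of_tendsto_of_tendsto_of_le_of_le tendsto_const_nhds hsum
    (fun _ => zero_le) fun n => ?_
  refine (measure_mono fun ω hω => ?_).trans (measure_biUnion_finset_le t _)
  by_contra hcon
  simp only [Set.mem_iUnion, Set.mem_ofPred_eq, not_exists, not_le] at hcon hω
  have k₁ := hbound (νn n ω) ((hνn n).1 ω)
  have k₂ : ∑ a ∈ t, |(∫ x, ψ a x ∂μ) - ∫ x, ψ a x ∂νn n ω| ≤ t.card * c := by
    simpa using Finset.sum_le_sum fun a ha => (hcon a ha).le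
  have k₃ : (t.card + 1) * c = δ / 4 := mul_div_cancel₀ _ (by positivity)
  linarith
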